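/- For every α ∈ (2π/3, π) there exists a constant c > 0 such that for every integer n ≥ 1 there exists a set V of n points in ℝ² and a plane α-bend multigraph on V with at least 6n − c·√n edges. -/

import Mathlib

open EuclideanGeometry Real Set

noncomputable section

/-- The Euclidean plane. -/
abbrev Pt : Type := EuclideanSpace ℝ (Fin 2)

/-- The image of a one-bend edge `(a,b,c)`: the union of segments `[a,b]` and `[b,c]`. -/
def bendImage (e : Pt × Pt × Pt) : Set Pt :=
  segment ℝ e.1 e.2.1 ∪ segment ℝ e.2.1 e.2.2

/-- The endpoints of a (bend or arc) edge `(a,b,c)` are `a` and `c`. -/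
def edgeEndpoints (e : Pt × Pt × Pt) : Set Pt := {e.1, e.2.2}

/-- An `α`-bend edge: a triple `(a,b,c)` with `a ≠ c` and angle `α` at `b`. -/
def IsBendEdge (α : ℝ) (e : Pt × Pt × Pt) : Prop :=
  e.1 ≠ e.2.2 ∧ ∠ e.1 e.2.1 e.2.2 = α

/-- A plane `α`-bend multigraph on a finite vertex set `V`. -/
def IsPlaneBendMultigraph (α : ℝ) (V : Finset Pt) (E : Finset (Pt × Pt × Pt)) : Prop :=
  (∀ e ∈ E, IsBendEdge α e ∧ e.1 ∈ V ∧ e.2.2 ∈ V) ∧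
  (∀ e ∈ E, ∀ f ∈ E, e ≠ f → bendImage e ≠ bendImage f) ∧
  (∀ e ∈ E, ∀ v ∈ V, (v : Pt) ∈ bendImage e → (v : Pt) ∈ edgeEndpoints e) ∧
  (∀ e ∈ E, ∀ f ∈ E, e ≠ f →
    bendImage e ∩ bendImage f ⊆ edgeEndpoints e ∩ edgeEndpoints f)

/-- A plane `α`-bend graph: a plane `α`-bend multigraph in which distinct edges
have distinct endpoint pairs. -/
def IsPlaneBendGraph (α : ℝ) (V : Finset Pt) (E : Finset (Pt × Pt × Pt)) : Prop :=
  IsPlaneBendMultigraph α V E ∧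
  ∀ e ∈ E, ∀ f ∈ E, e ≠ f → edgeEndpoints e ≠ edgeEndpoints f

/-- An `α`-arc edge: a triple `(a,b,c)` with `a ≠ c`, `b` off of the line `ac`,
and angle `α` at `b`. -/
def IsArcEdge (α : ℝ) (e : Pt × Pt × Pt) : Prop :=
  e.1 ≠ e.2.2 ∧ e.2.1 ∉ affineSpan ℝ ({e.1, e.2.2} : Set Pt) ∧ ∠ e.1 e.2.1 e.2.2 = α

/-- The image of an arc edge `(a,b,c)`: `{a,c}` together with the points strictly on the
same side of line `ac` as `b` from which the segment `ac` subtends the same angle as at `b`. -/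
def arcImage (e : Pt × Pt × Pt) : Set Pt :=
  ({e.1, e.2.2} : Set Pt) ∪
    {x : Pt | (affineSpan ℝ ({e.1, e.2.2} : Set Pt)).SSameSide x e.2.1 ∧
      ∠ e.1 x e.2.2 = ∠ e.1 e.2.1 e.2.2}

/-- A plane `α`-arc multigraph on a finite vertex set `V`. -/
def IsPlaneArcMultigraph (α : ℝ) (V : Finset Pt) (E : Finset (Pt × Pt × Pt)) : Prop :=
  (∀ e ∈ E, IsArcEdge α e ∧ e.1 ∈ V ∧ e.2.2 ∈ V) ∧
  (∀ e ∈ E, ∀ f ∈ E, e ≠ f → arcImage e ≠ arcImage f) ∧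
  (∀ e ∈ E, ∀ v ∈ V, (v : Pt) ∈ arcImage e → (v : Pt) ∈ edgeEndpoints e) ∧
  (∀ e ∈ E, ∀ f ∈ E, e ≠ f →
    arcImage e ∩ arcImage f ⊆ edgeEndpoints e ∩ edgeEndpoints f)

/-- A plane `α`-arc graph: a plane `α`-arc multigraph in which distinct edges
have distinct endpoint pairs. -/
def IsPlaneArcGraph (α : ℝ) (V : Finset Pt) (E : Finset (Pt × Pt × Pt)) : Prop :=
  IsPlaneArcMultigraph α V E ∧
  ∀ e ∈ E, ∀ f ∈ E, e ≠ f → edgeEndpoints e ≠ edgeEndpoints f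

/-- A finite point set is in general position if no three of its points are collinear. -/
def GenPos (P : Finset Pt) : Prop :=
  ∀ p ∈ P, ∀ q ∈ P, ∀ r ∈ P, p ≠ q → p ≠ r → q ≠ r →
    ¬ Collinear ℝ ({p, q, r} : Set Pt)

/-- A planar straight-line graph on `P`: edges are (ordered representatives of unordered)
pairs of distinct points of `P` whose closed segments pairwise intersect only in shared
endpoints, and no segment contains a point of `P` other than its endpoints. -/
def IsPSLG (P : Finset Pt) (E : Finset (Pt × Pt)) : Prop :=
  (∀ e ∈ E, e.1 ∈ P ∧ e.2 ∈ P ∧ e.1 ≠ e.2) ∧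
  (∀ e ∈ E, ∀ f ∈ E, e ≠ f → segment ℝ e.1 e.2 ≠ segment ℝ f.1 f.2) ∧
  (∀ e ∈ E, ∀ p ∈ P, (p : Pt) ∈ segment ℝ e.1 e.2 → p = e.1 ∨ p = e.2) ∧
  (∀ e ∈ E, ∀ f ∈ E, e ≠ f →
    segment ℝ e.1 e.2 ∩ segment ℝ f.1 f.2 ⊆ ({e.1, e.2} : Set Pt) ∩ ({f.1, f.2} : Set Pt))

/-- `M P`: the maximum number of edges of a planar straight-line graph on `P`. -/
def M (P : Finset Pt) : ℕ :=
  sSup {m : ℕ | ∃ E : Finset (Pt × Pt), IsPSLG P E ∧ E.card = m}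

/-- Two segments (given by their endpoint pairs) cross: they meet in exactly one point,
which lies in the relative interior (open segment) of both. -/
def SegCross (s t : Pt × Pt) : Prop :=
  ∃ x : Pt, segment ℝ s.1 s.2 ∩ segment ℝ t.1 t.2 = {x} ∧
    x ∈ openSegment ℝ s.1 s.2 ∧ x ∈ openSegment ℝ t.1 t.2


lemma hex_int (B C : ℤ) : B + C ≤ B^2 + B*C + C^2 := by
  have h1 : ∀ k : ℤ, k ≤ k^2 := fun k => by
    rcases le_or_gt k 0 with h | h <;> nlinarith
  rcases le_or_gt 0 (B*C) with h | h
  · linarith [h1 B, h1 C]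
  · nlinarith [h1 (B+C)]

lemma hex_core (B C : ℤ) (s τ : ℝ) (hs0 : 0 < s) (hs1 : s < 1) (h1 : |τ| < s) (h2 : |τ| < 1 - s)
    (hz : ¬ (B = 0 ∧ C = 0)) (ho : ¬ (B = 0 ∧ C = 1)) :
    s * (B + 2 * C) + τ * B < (B:ℝ)^2 + B*C + C^2 := by
  by_cases hB : B = 0
  · subst hB
    have hC0 : C ≠ 0 := fun h => hz ⟨rfl, h⟩
    have hC1 : C ≠ 1 := fun h => ho ⟨rfl, h⟩
    rcases lt_or_ge C 0 with h | h
    · have : (C:ℝ) < 0 := by exact_mod_cast h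
      push_cast; nlinarith
    · have : (2:ℝ) ≤ C := by exact_mod_cast (show (2:ℤ) ≤ C by omega)
      push_cast; nlinarith
  · have e1 : (B:ℝ) + C ≤ (B:ℝ)^2 + B*C + C^2 := by exact_mod_cast hex_int B C
    have e2 : (C:ℝ) ≤ (B:ℝ)^2 + B*C + C^2 := by
      have := hex_int (-B) (B+C)
      have h : C ≤ B^2 + B*C + C^2 := by linarith
      exact_mod_cast h
    have e3 : (B:ℝ) + 2 * C ≤ (B:ℝ)^2 + B*C + C^2 := by
      have : B + 2 * C ≤ B^2 + B*C + C^2 := by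
        have hb : 1 ≤ B^2 := by
          have : 0 < B^2 := by positivity
          omega
        nlinarith [sq_nonneg (B + 2*C - 2), Int.emod_two_eq_zero_or_one B]
      exact_mod_cast this
    have e0 : 0 ≤ (B:ℝ)^2 + B*C + C^2 := by nlinarith [sq_nonneg ((B:ℝ)+C), sq_nonneg (B:ℝ), sq_nonneg (C:ℝ)]
    set N : ℝ := (B:ℝ)^2 + B*C + C^2
    have hBr : (B:ℝ) ≠ 0 := by exact_mod_cast hB
    have habs : 0 < |(B:ℝ)| := abs_pos.mpr hBr
    have hT : (B:ℝ) + 2 * C + |(B:ℝ)| ≤ 2 * N := by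
      rcases abs_cases (B:ℝ) with ⟨h, _⟩ | ⟨h, _⟩ <;> rw [h] <;> linarith
    have ht : τ * B ≤ |τ| * |(B:ℝ)| := by rw [← abs_mul]; exact le_abs_self _
    rcases le_or_gt s (1/2) with h | h
    · have : |τ| * |(B:ℝ)| < s * |(B:ℝ)| := by gcongr
      nlinarith
    · have : |τ| * |(B:ℝ)| < (1-s) * |(B:ℝ)| := by gcongr
      nlinarith

def LP (i j : ℤ) : Pt := !₂[(i:ℝ) - j/2, j*(√3/2)]

lemma LP_zero (i j : ℤ) : LP i j 0 = (i:ℝ) - j/2 := by simp [LP]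
lemma LP_one (i j : ℤ) : LP i j 1 = j*(√3/2) := by simp [LP]

lemma sq3 : √3 * √3 = (3:ℝ) := Real.mul_self_sqrt (by norm_num)
lemma pos3 : 0 < √(3:ℝ) := Real.sqrt_pos.mpr (by norm_num)

/-- The point with local coordinates `(s,t)` relative to the edge at `(i,j)` with direction `(a,b)`. -/
def loc (i j a b : ℤ) (s t : ℝ) : Pt :=
  !₂[LP i j 0 + s * LP a b 0 - t * LP a b 1, LP i j 1 + s * LP a b 1 + t * LP a b 0]

lemma loc_zero (i j a b : ℤ) (s t : ℝ) :
    loc i j a b s t 0 = LP i j 0 + s * LP a b 0 - t * LP a b 1 := by simp [loc]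
lemma loc_one (i j a b : ℤ) (s t : ℝ) :
    loc i j a b s t 1 = LP i j 1 + s * LP a b 1 + t * LP a b 0 := by simp [loc]

lemma pt_ext {x y : Pt} (h0 : x 0 = y 0) (h1 : x 1 = y 1) : x = y := by
  ext k; fin_cases k <;> assumption

lemma loc_start (i j a b : ℤ) : loc i j a b 0 0 = LP i j := by
  apply pt_ext <;> simp [loc_zero, loc_one]

lemma loc_end (i j a b : ℤ) : loc i j a b 1 0 = LP (i+a) (j+b) := by
  apply pt_ext <;> simp [loc_zero, loc_one, LP_zero, LP_one] <;> ring

lemma LP_inj {i j i' j' : ℤ} (h : LP i j = LP i' j') : i = i' ∧ j = j' := by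
  have h0 : LP i j 0 = LP i' j' 0 := by rw [h]
  have h1 : LP i j 1 = LP i' j' 1 := by rw [h]
  rw [LP_one, LP_one] at h1
  rw [LP_zero, LP_zero] at h0
  have hj : (j:ℝ) = j' := by
    have := pos3
    exact mul_right_cancel₀ (by positivity) h1
  rw [hj] at h0
  have hi : (i:ℝ) = i' := by linarith
  exact ⟨by exact_mod_cast hi, by exact_mod_cast hj⟩

/-- squared distance -/
def sqd (x y : Pt) : ℝ := (x 0 - y 0)^2 + (x 1 - y 1)^2

lemma sqd_nonneg (x y : Pt) : 0 ≤ sqd x y := by unfold sqd; positivity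
lemma sqd_self (x : Pt) : sqd x x = 0 := by simp [sqd]

def DirOK (a b : ℤ) : Prop := (a = 1 ∧ b = 0) ∨ (a = 0 ∧ b = 1) ∨ (a = 1 ∧ b = 1)

lemma near_start (i j a b m n : ℤ) (hd : DirOK a b ∨ DirOK (-a) (-b)) (s t : ℝ)
    (hs0 : 0 < s) (hs1 : s < 1)
    (h1 : √3 * |t| < s) (h2 : √3 * |t| < 1 - s)
    (hp : (m, n) ≠ (i, j)) (hq : (m, n) ≠ (i+a, j+b)) :
    sqd (loc i j a b s t) (LP i j) < sqd (loc i j a b s t) (LP m n) := by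
  obtain ⟨M, rfl⟩ : ∃ M, m = i + M := ⟨m - i, by ring⟩
  obtain ⟨N, rfl⟩ : ∃ N, n = j + N := ⟨n - j, by ring⟩
  have hd6 : (a = 1 ∧ b = 0) ∨ (a = 0 ∧ b = 1) ∨ (a = 1 ∧ b = 1) ∨ (a = -1 ∧ b = 0) ∨
      (a = 0 ∧ b = -1) ∨ (a = -1 ∧ b = -1) := by
    unfold DirOK at hd
    omega
  have h3 : |√3 * t| = √3 * |t| := by rw [abs_mul, abs_of_pos pos3]
  have key := hex_core (a*N - b*M) (a*M - a*N + b*N) s (√3*t) hs0 hs1 (by rwa [h3]) (by rwa [h3])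
    (by
      rintro ⟨e1, e2⟩
      apply hp
      rcases hd6 with ⟨rfl, rfl⟩ | ⟨rfl, rfl⟩ | ⟨rfl, rfl⟩ | ⟨rfl, rfl⟩ | ⟨rfl, rfl⟩ | ⟨rfl, rfl⟩ <;>
        (ext <;> simp <;> omega))
    (by
      rintro ⟨e1, e2⟩
      apply hq
      rcases hd6 with ⟨rfl, rfl⟩ | ⟨rfl, rfl⟩ | ⟨rfl, rfl⟩ | ⟨rfl, rfl⟩ | ⟨rfl, rfl⟩ | ⟨rfl, rfl⟩ <;>
        (ext <;> simp <;> omega))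
  have hn : (a:ℝ)^2 - a*b + b^2 = 1 := by
    rcases hd6 with ⟨rfl, rfl⟩ | ⟨rfl, rfl⟩ | ⟨rfl, rfl⟩ | ⟨rfl, rfl⟩ | ⟨rfl, rfl⟩ | ⟨rfl, rfl⟩ <;>
        norm_num
  have h33 := sq3
  have hN : (M:ℝ)^2 - M*N + N^2 = ((a*N - b*M:ℤ):ℝ)^2 + ((a*N - b*M:ℤ):ℝ) * ((a*M - a*N + b*N:ℤ):ℝ)
      + ((a*M - a*N + b*N:ℤ):ℝ)^2 := by
    push_cast
    linear_combination (-(M:ℝ)^2 + M*N - N^2) * hn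
  have hdiff : sqd (loc i j a b s t) (LP (i+M) (j+N)) - sqd (loc i j a b s t) (LP i j)
      = ((M:ℝ)^2 - M*N + N^2) - (s * (((a*N - b*M:ℤ):ℝ) + 2 * ((a*M - a*N + b*N:ℤ):ℝ))
        + √3*t * ((a*N - b*M:ℤ):ℝ)) := by
    unfold sqd
    rw [loc_zero, loc_one]
    simp only [LP_zero, LP_one]
    push_cast
    generalize √(3:ℝ) = r at *
    linear_combination ((N:ℝ)^2/4 - s * b * N/2) * h33
  linarith

lemma loc_rev (i j a b : ℤ) (s t : ℝ) :
    loc i j a b s t = loc (i+a) (j+b) (-a) (-b) (1-s) (-t) := by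
  apply pt_ext <;> simp [loc_zero, loc_one, LP_zero, LP_one] <;> ring

lemma near_end (i j a b m n : ℤ) (hd : DirOK a b) (s t : ℝ)
    (hs0 : 0 < s) (hs1 : s < 1)
    (h1 : √3 * |t| < s) (h2 : √3 * |t| < 1 - s)
    (hp : (m, n) ≠ (i, j)) (hq : (m, n) ≠ (i+a, j+b)) :
    sqd (loc i j a b s t) (LP (i+a) (j+b)) < sqd (loc i j a b s t) (LP m n) := by
  rw [loc_rev]
  apply near_start (i+a) (j+b) (-a) (-b) m n (by right; simpa using hd) (1-s) (-t)
    (by linarith) (by linarith) (by rwa [abs_neg]) (by rw [abs_neg]; linarith) hq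
  simpa using hp

def edge (h : ℝ) (i j a b : ℤ) (σ : ℝ) : Pt × Pt × Pt :=
  (LP i j, loc i j a b (1/2) (σ * h / 2), LP (i+a) (j+b))

lemma mem_edge {h : ℝ} {i j a b : ℤ} {σ : ℝ} {x : Pt} (hx : x ∈ bendImage (edge h i j a b σ)) :
    ∃ s : ℝ, 0 ≤ s ∧ s ≤ 1 ∧ x = loc i j a b s (σ * h * min s (1-s)) := by
  rcases hx with hx | hx
  · obtain ⟨u, v, hu, hv, huv, rfl⟩ := hx
    refine ⟨v/2, by linarith, by linarith, ?_⟩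
    rw [min_eq_left (by linarith)]
    obtain rfl : u = 1 - v := by linarith
    apply pt_ext <;> simp [edge, loc_zero, loc_one] <;> ring
  · obtain ⟨u, v, hu, hv, huv, rfl⟩ := hx
    refine ⟨u/2 + v, by linarith, by linarith, ?_⟩
    rw [min_eq_right (by linarith)]
    obtain rfl : u = 1 - v := by linarith
    apply pt_ext <;> simp [edge, loc_zero, loc_one, LP_zero, LP_one] <;> ring

/-- Either an endpoint, or a point in the open rhombus. -/
lemma mem_edge' {h : ℝ} (h0 : 0 < h) (h1 : √3 * h < 1) {i j a b : ℤ} {σ : ℝ} (hσ : σ = 1 ∨ σ = -1)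
    {x : Pt} (hx : x ∈ bendImage (edge h i j a b σ)) :
    x = LP i j ∨ x = LP (i+a) (j+b) ∨ ∃ s t : ℝ, 0 < s ∧ s < 1 ∧ 0 < σ * t ∧ √3 * |t| < s ∧
      √3 * |t| < 1 - s ∧ x = loc i j a b s t := by
  obtain ⟨s, hs0, hs1, rfl⟩ := mem_edge hx
  rcases hs0.eq_or_lt with rfl | hs0
  · left; simpa using loc_start i j a b
  rcases hs1.eq_or_lt with rfl | hs1
  · right; left; simpa using loc_end i j a b
  right; right
  have hm : 0 < min s (1-s) := lt_min hs0 (by linarith)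
  have habs : |σ * h * min s (1-s)| = h * min s (1-s) := by
    rw [abs_mul, abs_mul, abs_of_pos h0, abs_of_pos hm]
    rcases hσ with rfl | rfl <;> simp
  have hlt : √3 * |σ * h * min s (1-s)| < min s (1-s) := by
    rw [habs, ← mul_assoc]
    nlinarith
  refine ⟨s, _, hs0, hs1, ?_, hlt.trans_le (min_le_left _ _), hlt.trans_le (min_le_right _ _), rfl⟩
  have : 0 < h * min s (1-s) := by positivity
  rcases hσ with rfl | rfl <;> linarith

lemma loc_inj {i j a b : ℤ} (hd : DirOK a b) {s t s' t' : ℝ}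
    (he : loc i j a b s t = loc i j a b s' t') : t = t' := by
  have h0 : loc i j a b s t 0 = loc i j a b s' t' 0 := by rw [he]
  have h1 : loc i j a b s t 1 = loc i j a b s' t' 1 := by rw [he]
  rw [loc_zero, loc_zero] at h0
  rw [loc_one, loc_one] at h1
  have hn : (LP a b 0)^2 + (LP a b 1)^2 = 1 := by
    rw [LP_zero, LP_one]
    have := sq3
    rcases hd with ⟨rfl, rfl⟩ | ⟨rfl, rfl⟩ | ⟨rfl, rfl⟩ <;> push_cast <;> nlinarith
  linear_combination (-LP a b 1) * h0 + (LP a b 0) * h1 + (t' - t) * hn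

lemma lattice_mem {h : ℝ} (h0 : 0 < h) (h1 : √3 * h < 1) {i j a b : ℤ} (hd : DirOK a b) {σ : ℝ}
    (hσ : σ = 1 ∨ σ = -1) {m n : ℤ} (hx : LP m n ∈ bendImage (edge h i j a b σ)) :
    LP m n ∈ edgeEndpoints (edge h i j a b σ) := by
  rcases mem_edge' h0 h1 hσ hx with h | h | ⟨s, t, hs0, hs1, -, ht1, ht2, hx⟩
  · exact Or.inl h
  · exact Or.inr h
  · by_contra hc
    have := near_start i j a b m n (Or.inl hd) s t hs0 hs1 ht1 ht2
      (by intro h; obtain ⟨rfl, rfl⟩ := Prod.mk.inj h; exact hc (Or.inl rfl))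
      (by intro h; obtain ⟨rfl, rfl⟩ := Prod.mk.inj h; exact hc (Or.inr rfl))
    rw [← hx, sqd_self] at this
    exact absurd (sqd_nonneg _ _) (not_le.mpr this)

lemma edges_disjoint {h : ℝ} (h0 : 0 < h) (h1 : √3 * h < 1) {i j a b i' j' a' b' : ℤ}
    (hd : DirOK a b) (hd' : DirOK a' b') {σ σ' : ℝ}
    (hσ : σ = 1 ∨ σ = -1) (hσ' : σ' = 1 ∨ σ' = -1)
    (hne : ¬ (i = i' ∧ j = j' ∧ a = a' ∧ b = b' ∧ σ = σ')) {x : Pt}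
    (hx : x ∈ bendImage (edge h i j a b σ)) (hx' : x ∈ bendImage (edge h i' j' a' b' σ')) :
    x ∈ edgeEndpoints (edge h i j a b σ) ∧ x ∈ edgeEndpoints (edge h i' j' a' b' σ') := by
  rcases mem_edge' h0 h1 hσ hx with rfl | rfl | ⟨s, t, hs0, hs1, hst, ht1, ht2, hxe⟩
  · exact ⟨lattice_mem h0 h1 hd hσ hx, lattice_mem h0 h1 hd' hσ' hx'⟩
  · exact ⟨lattice_mem h0 h1 hd hσ hx, lattice_mem h0 h1 hd' hσ' hx'⟩
  rcases mem_edge' h0 h1 hσ' hx' with rfl | rfl | ⟨s', t', hs0', hs1', hst', ht1', ht2', hxe'⟩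
  · exact ⟨lattice_mem h0 h1 hd hσ hx, lattice_mem h0 h1 hd' hσ' hx'⟩
  · exact ⟨lattice_mem h0 h1 hd hσ hx, lattice_mem h0 h1 hd' hσ' hx'⟩
  exfalso
  have ns : ∀ m n, (m, n) ≠ (i, j) → (m, n) ≠ (i+a, j+b) → sqd x (LP i j) < sqd x (LP m n) := by
    intro m n hp hq; rw [hxe]; exact near_start i j a b m n (Or.inl hd) s t hs0 hs1 ht1 ht2 hp hq
  have ne : ∀ m n, (m, n) ≠ (i, j) → (m, n) ≠ (i+a, j+b) →
      sqd x (LP (i+a) (j+b)) < sqd x (LP m n) := by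
    intro m n hp hq; rw [hxe]; exact near_end i j a b m n hd s t hs0 hs1 ht1 ht2 hp hq
  have ns' : ∀ m n, (m, n) ≠ (i', j') → (m, n) ≠ (i'+a', j'+b') →
      sqd x (LP i' j') < sqd x (LP m n) := by
    intro m n hp hq; rw [hxe']
    exact near_start i' j' a' b' m n (Or.inl hd') s' t' hs0' hs1' ht1' ht2' hp hq
  have ne' : ∀ m n, (m, n) ≠ (i', j') → (m, n) ≠ (i'+a', j'+b') →
      sqd x (LP (i'+a') (j'+b')) < sqd x (LP m n) := by
    intro m n hp hq; rw [hxe']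
    exact near_end i' j' a' b' m n hd' s' t' hs0' hs1' ht1' ht2' hp hq
  by_cases hsame : i = i' ∧ j = j' ∧ a = a' ∧ b = b'
  · obtain ⟨rfl, rfl, rfl, rfl⟩ := hsame
    obtain rfl : t = t' := loc_inj hd (hxe.symm.trans hxe')
    apply hne
    refine ⟨rfl, rfl, rfl, rfl, ?_⟩
    rcases hσ with rfl | rfl <;> rcases hσ' with rfl | rfl <;> first | rfl | (exfalso; linarith)
  · have A : ((i', j') ≠ (i, j) ∧ (i', j') ≠ (i+a, j+b)) ∨
        ((i'+a', j'+b') ≠ (i, j) ∧ (i'+a', j'+b') ≠ (i+a, j+b)) := by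
      simp only [ne_eq, Prod.mk.injEq]
      unfold DirOK at hd hd'
      omega
    have B : ((i, j) ≠ (i', j') ∧ (i, j) ≠ (i'+a', j'+b')) ∨
        ((i+a, j+b) ≠ (i', j') ∧ (i+a, j+b) ≠ (i'+a', j'+b')) := by
      simp only [ne_eq, Prod.mk.injEq]
      unfold DirOK at hd hd'
      omega
    rcases A with ⟨p, q⟩ | ⟨p, q⟩ <;> rcases B with ⟨p', q'⟩ | ⟨p', q'⟩
    · exact lt_asymm (ns _ _ p q) (ns' _ _ p' q')
    · exact lt_asymm (ne _ _ p q) (ns' _ _ p' q')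
    · exact lt_asymm (ns _ _ p q) (ne' _ _ p' q')
    · exact lt_asymm (ne _ _ p q) (ne' _ _ p' q')

lemma edge_angle (α : ℝ) (hα : α ∈ Set.Ioo (2 * π / 3) π) (i j a b : ℤ) (hd : DirOK a b) (σ : ℝ)
    (hσ : σ = 1 ∨ σ = -1) : IsBendEdge α (edge (Real.tan ((π - α)/2)) i j a b σ) := by
  have hpi := Real.pi_pos
  obtain ⟨ha1, ha2⟩ := hα
  set φ := (π - α)/2 with hφ
  have hcos : 0 < Real.cos φ := Real.cos_pos_of_mem_Ioo ⟨by linarith, by linarith⟩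
  have hcα : Real.cos α = 1 - 2 * Real.cos φ ^ 2 := by
    have : α = π - 2 * φ := by rw [hφ]; ring
    rw [this, Real.cos_pi_sub, Real.cos_two_mul]; ring
  have hσ2 : σ^2 = 1 := by rcases hσ with rfl | rfl <;> norm_num
  have ht : Real.tan φ ^ 2 * Real.cos φ ^ 2 = 1 - Real.cos φ ^ 2 := by
    rw [← mul_pow, Real.tan_mul_cos hcos.ne', Real.sin_sq]
  have hn : (LP a b 0)^2 + (LP a b 1)^2 = 1 := by
    rw [LP_zero, LP_one]
    have := sq3
    rcases hd with ⟨rfl, rfl⟩ | ⟨rfl, rfl⟩ | ⟨rfl, rfl⟩ <;> push_cast <;> nlinarith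
  constructor
  · intro h
    have := LP_inj h
    unfold DirOK at hd
    omega
  · set T := Real.tan φ
    have hend : LP (i+a) (j+b) = loc i j a b 1 0 := (loc_end i j a b).symm
    have hT : 0 < 1 + T^2 := by positivity
    have hn1 : ‖LP i j -ᵥ loc i j a b (1/2) (σ * T / 2)‖ = √((1 + T^2)/4) := by
      rw [EuclideanSpace.norm_eq]
      congr 1
      simp [Fin.sum_univ_two, loc_zero, loc_one]
      linear_combination (1/4 + σ^2 * T^2/4) * hn + T^2/4 * hσ2
    have hn2 : ‖LP (i+a) (j+b) -ᵥ loc i j a b (1/2) (σ * T / 2)‖ = √((1 + T^2)/4) := by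
      rw [EuclideanSpace.norm_eq, hend]
      congr 1
      simp [Fin.sum_univ_two, loc_zero, loc_one]
      linear_combination (1/4 + σ^2 * T^2/4) * hn + T^2/4 * hσ2
    have hin : inner ℝ (LP i j -ᵥ loc i j a b (1/2) (σ * T / 2))
        (LP (i+a) (j+b) -ᵥ loc i j a b (1/2) (σ * T / 2)) = (T^2 - 1)/4 := by
      rw [hend]
      simp [PiLp.inner_apply, Fin.sum_univ_two, loc_zero, loc_one]
      linear_combination (-1/4 + σ^2 * T^2/4) * hn + T^2/4 * hσ2
    show InnerProductGeometry.angle _ _ = α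
    unfold InnerProductGeometry.angle
    simp only [edge]
    rw [hn1, hn2, hin, Real.mul_self_sqrt (by positivity)]
    have : (T^2 - 1)/4 / ((1 + T^2)/4) = Real.cos α := by
      rw [hcα]
      field_simp
      linear_combination 2 * ht
    rw [this, Real.arccos_cos (by linarith) (by linarith)]

lemma tan_bounds (α : ℝ) (hα : α ∈ Set.Ioo (2 * π / 3) π) :
    0 < Real.tan ((π - α)/2) ∧ √3 * Real.tan ((π - α)/2) < 1 := by
  have hpi := Real.pi_pos
  obtain ⟨ha1, ha2⟩ := hα
  refine ⟨Real.tan_pos_of_pos_of_lt_pi_div_two (by linarith) (by linarith), ?_⟩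
  have := Real.tan_lt_tan_of_lt_of_lt_pi_div_two (x := (π - α)/2) (y := π/6)
    (by linarith) (by linarith) (by linarith)
  rw [Real.tan_pi_div_six] at this
  have h3 := pos3
  rw [lt_div_iff₀ h3] at this
  linarith

def dirF : Fin 3 → ℤ × ℤ := ![(1,0),(0,1),(1,1)]
lemma dirF_ok (k : Fin 3) : DirOK (dirF k).1 (dirF k).2 := by
  fin_cases k <;> simp [dirF, DirOK]
lemma dirF_inj : Function.Injective dirF := by decide

def sgF (k : Bool) : ℝ := if k then 1 else -1
lemma sgF_ok (k : Bool) : sgF k = 1 ∨ sgF k = -1 := by cases k <;> simp [sgF]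
lemma sgF_inj : Function.Injective sgF := by
  intro a b; cases a <;> cases b <;> simp [sgF] <;> norm_num

def edgeF (h : ℝ) (q : (ℤ × ℤ) × Fin 3 × Bool) : Pt × Pt × Pt :=
  edge h q.1.1 q.1.2 (dirF q.2.1).1 (dirF q.2.1).2 (sgF q.2.2)

lemma edgeF_disjoint {h : ℝ} (h0 : 0 < h) (h1 : √3 * h < 1) {q q' : (ℤ × ℤ) × Fin 3 × Bool}
    (hne : q ≠ q') : bendImage (edgeF h q) ∩ bendImage (edgeF h q') ⊆
      edgeEndpoints (edgeF h q) ∩ edgeEndpoints (edgeF h q') := by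
  rintro x ⟨hx, hx'⟩
  refine edges_disjoint h0 h1 (dirF_ok _) (dirF_ok _) (sgF_ok _) (sgF_ok _) ?_ hx hx'
  rintro ⟨e1, e2, e3, e4, e5⟩
  apply hne
  obtain ⟨⟨i, j⟩, k, l⟩ := q
  obtain ⟨⟨i', j'⟩, k', l'⟩ := q'
  simp only at *
  rw [e1, e2, dirF_inj (Prod.ext e3 e4), sgF_inj e5]

lemma bend_not_end {h : ℝ} (h0 : 0 < h) (q : (ℤ × ℤ) × Fin 3 × Bool) :
    (edgeF h q).2.1 ∉ edgeEndpoints (edgeF h q) := by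
  have key := sgF_ok q.2.2
  rintro (he | he)
  · have he' : loc q.1.1 q.1.2 (dirF q.2.1).1 (dirF q.2.1).2 (1/2) (sgF q.2.2 * h / 2)
      = LP q.1.1 q.1.2 := he
    rw [← loc_start _ _ (dirF q.2.1).1 (dirF q.2.1).2] at he'
    have := loc_inj (dirF_ok _) he'
    rcases key with k | k <;> rw [k] at this <;> linarith
  · have he' : loc q.1.1 q.1.2 (dirF q.2.1).1 (dirF q.2.1).2 (1/2) (sgF q.2.2 * h / 2)
      = LP (q.1.1 + (dirF q.2.1).1) (q.1.2 + (dirF q.2.1).2) := he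
    rw [← loc_end] at he'
    have := loc_inj (dirF_ok _) he'
    rcases key with k | k <;> rw [k] at this <;> linarith

lemma bend_mem (e : Pt × Pt × Pt) : e.2.1 ∈ bendImage e := Or.inl (right_mem_segment _ _ _)

theorem stmt_15 (α : ℝ) (hα : α ∈ Set.Ioo (2 * π / 3) π) :
    ∃ c : ℝ, 0 < c ∧ ∀ n : ℕ, 1 ≤ n →
      ∃ (V : Finset Pt) (E : Finset (Pt × Pt × Pt)), V.card = n ∧
        IsPlaneBendMultigraph α V E ∧
        6 * (n : ℝ) - c * Real.sqrt n ≤ (E.card : ℝ) := by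
  classical
  obtain ⟨h0, h1⟩ := tan_bounds α hα
  have hang := edge_angle α hα
  set h := Real.tan ((π - α)/2)
  refine ⟨24, by norm_num, fun n hn => ?_⟩
  set m := Nat.sqrt n with hm
  have hm1 : m * m ≤ n := Nat.sqrt_le n
  have hm2 : n ≤ m * m + m + m := Nat.sqrt_le_add n
  have hm0 : 1 ≤ m := by
    rw [hm]; exact Nat.sqrt_pos.mpr hn
  set G : Finset (ℤ × ℤ) := Finset.Ico 0 (m:ℤ) ×ˢ Finset.Ico 0 (m:ℤ) with hG
  obtain ⟨W, hGW, hW⟩ := Infinite.exists_superset_card_eq G n (by simpa [hG] using hm1)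
  set I : Finset ((ℤ × ℤ) × Fin 3 × Bool) :=
    (Finset.Ico 0 (m-1:ℤ) ×ˢ Finset.Ico 0 (m-1:ℤ)) ×ˢ Finset.univ with hI
  have hEne : ∀ q q' : (ℤ × ℤ) × Fin 3 × Bool, q ≠ q' →
      bendImage (edgeF h q) ≠ bendImage (edgeF h q') := by
    intro q q' hne heq
    refine bend_not_end h0 q (edgeF_disjoint h0 h1 hne ⟨bend_mem _, ?_⟩).1
    rw [← heq]; exact bend_mem _
  have hEinj : Function.Injective (edgeF h) := by
    intro q q' heq
    by_contra hne
    exact hEne q q' hne (by rw [heq])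
  have hLinj : Function.Injective (fun p : ℤ × ℤ => LP p.1 p.2) := by
    intro p p' hp
    obtain ⟨e1, e2⟩ := LP_inj hp
    exact Prod.ext e1 e2
  refine ⟨W.image (fun p : ℤ × ℤ => LP p.1 p.2), I.image (edgeF h), ?_, ⟨?_, ?_, ?_, ?_⟩, ?_⟩
  · rw [Finset.card_image_of_injective _ hLinj, hW]
  · intro e he
    obtain ⟨⟨⟨i, j⟩, k, l⟩, hq, rfl⟩ := Finset.mem_image.mp he
    simp only [hI, Finset.mem_product, Finset.mem_Ico, Finset.mem_univ, and_true] at hq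
    have hd := dirF_ok k
    refine ⟨hang _ _ _ _ hd _ (sgF_ok _), ?_, ?_⟩
    · refine Finset.mem_image.mpr ⟨(i, j), hGW ?_, rfl⟩
      simp only [hG, Finset.mem_product, Finset.mem_Ico]
      omega
    · refine Finset.mem_image.mpr ⟨(i + (dirF k).1, j + (dirF k).2), hGW ?_, rfl⟩
      simp only [hG, Finset.mem_product, Finset.mem_Ico]
      unfold DirOK at hd
      omega
  · intro e he f hf hne
    obtain ⟨q, hq, rfl⟩ := Finset.mem_image.mp he
    obtain ⟨q', hq', rfl⟩ := Finset.mem_image.mp hf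
    exact hEne q q' (fun h => hne (by rw [h]))
  · intro e he v hv hve
    obtain ⟨q, hq, rfl⟩ := Finset.mem_image.mp he
    obtain ⟨p, hp, rfl⟩ := Finset.mem_image.mp hv
    exact lattice_mem h0 h1 (dirF_ok _) (sgF_ok _) hve
  · intro e he f hf hne
    obtain ⟨q, hq, rfl⟩ := Finset.mem_image.mp he
    obtain ⟨q', hq', rfl⟩ := Finset.mem_image.mp hf
    exact edgeF_disjoint h0 h1 (fun h => hne (by rw [h]))
  · rw [Finset.card_image_of_injective _ hEinj]
    have hc : I.card = (m-1)*(m-1)*6 := by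
      have : ((m:ℤ) - 1).toNat = m - 1 := by omega
      simp [hI, this]
    rw [hc]
    obtain ⟨k, hk⟩ : ∃ k, m = k + 1 := ⟨m - 1, by omega⟩
    have hs : (m:ℝ) ≤ √n := by
      apply Real.le_sqrt_of_sq_le
      rw [sq]; exact_mod_cast hm1
    have hn2 : (n:ℝ) ≤ m * m + m + m := by exact_mod_cast hm2
    rw [hk] at hs hn2 ⊢
    push_cast at hs hn2 ⊢
    nlinarith
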